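/- arXiv:math/9805111 — 3 statements merged into one kernel-verified Lean document; each statement's English description precedes it below -/
import Mathlib

section
/- Let g : X → X be a map with f ∘ g = g ∘ f, let m ∈ ℕ and let C′ ≥ 0 be such that |h(g(x)) − m·h(x)| ≤ C′ for every x ∈ X. Then ĥ(g(x)) = m·ĥ(x) for every x ∈ X. -/
/-- The canonical height scales correctly under any map `g` commuting with `f` for which `h`
quasi-scales by `m`. -/
theorem canonical_height_scaling {X : Type*} (f : X → X) (h : X → ℝ)
    (n : ℕ) (hn : 2 ≤ n) (C : ℝ) (hC : 0 ≤ C)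
    (hbd : ∀ x : X, |h (f x) - (n : ℝ) * h x| ≤ C)
    (hcan : X → ℝ)
    (hlim : ∀ x : X,
      Filter.Tendsto (fun k : ℕ => h (f^[k] x) / (n : ℝ) ^ k) Filter.atTop (nhds (hcan x)))
    (g : X → X) (hcomm : f ∘ g = g ∘ f)
    (m : ℕ) (C' : ℝ) (hC' : 0 ≤ C')
    (hgb : ∀ x : X, |h (g x) - (m : ℝ) * h x| ≤ C') :
    ∀ x : X, hcan (g x) = (m : ℝ) * hcan x := by
  intro x
  have hn1 : (1 : ℝ) < (n : ℝ) := by exact_mod_cast hn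
  have hc : Function.Commute f g := fun y => congrFun hcomm y
  have h1 := (hlim (g x)).sub ((hlim x).const_mul (m : ℝ))
  have h2 : Filter.Tendsto (fun k : ℕ => C' / (n : ℝ) ^ k) Filter.atTop (nhds 0) :=
    (tendsto_pow_atTop_atTop_of_one_lt hn1).const_div_atTop C'
  have h3 := squeeze_zero_norm (f := fun k : ℕ =>
    h (f^[k] (g x)) / (n : ℝ) ^ k - (m : ℝ) * (h (f^[k] x) / (n : ℝ) ^ k)) (fun k => by
      have hp : (0 : ℝ) < (n : ℝ) ^ k := by positivity
      have e : f^[k] (g x) = g (f^[k] x) := hc.iterate_left k x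
      rw [Real.norm_eq_abs, e, ← mul_div_assoc, ← sub_div, abs_div, abs_of_pos hp]
      exact div_le_div_of_nonneg_right (hgb _) hp.le) h2
  exact sub_eq_zero.mp (tendsto_nhds_unique h1 h3)
end

section
/- Let f′ : X → X be a map with f ∘ f′ = f′ ∘ f, let n′ ≥ 2 be an integer and C″ ≥ 0 be such that |h(f′(x)) − n′·h(x)| ≤ C″ for every x ∈ X. Then for every x ∈ X, the sequence k ↦ h(f′^[k](x))/(n′)^k converges and its limit equals ĥ(x); that is, the canonical heights constructed from f and from f′ coincide. -/
/-- Independence of the canonical height from the chosen map: the Tate limit built from a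
commuting map `f'` with multiplier `n' ≥ 2` converges to the same canonical height. -/
theorem canonical_height_independent {X : Type*} (f : X → X) (h : X → ℝ)
    (n : ℕ) (hn : 2 ≤ n) (C : ℝ) (hC : 0 ≤ C)
    (hbd : ∀ x : X, |h (f x) - (n : ℝ) * h x| ≤ C)
    (hcan : X → ℝ)
    (hlim : ∀ x : X,
      Filter.Tendsto (fun k : ℕ => h (f^[k] x) / (n : ℝ) ^ k) Filter.atTop (nhds (hcan x)))
    (f' : X → X) (hcomm : f ∘ f' = f' ∘ f)
    (n' : ℕ) (hn' : 2 ≤ n') (C'' : ℝ) (hC'' : 0 ≤ C'')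
    (hbd' : ∀ x : X, |h (f' x) - (n' : ℝ) * h x| ≤ C'') :
    ∀ x : X,
      Filter.Tendsto (fun k : ℕ => h (f'^[k] x) / (n' : ℝ) ^ k) Filter.atTop (nhds (hcan x)) := by
  have hn0 : (2 : ℝ) ≤ n := by exact_mod_cast hn
  have hn0' : (2 : ℝ) ≤ n' := by exact_mod_cast hn'
  have h1 : ∀ (k : ℕ) (x : X), |h (f^[k] x) - (n : ℝ) ^ k * h x| ≤ C * ((n : ℝ) ^ k - 1) := by
    intro k x
    induction k with
    | zero => simp
    | succ k ih =>
      rw [Function.iterate_succ_apply']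
      have e := hbd (f^[k] x)
      have e2 : |(n : ℝ) * (h (f^[k] x) - (n : ℝ) ^ k * h x)|
          ≤ n * (C * ((n : ℝ) ^ k - 1)) := by
        rw [abs_mul, abs_of_nonneg (by linarith : (0 : ℝ) ≤ n)]
        exact mul_le_mul_of_nonneg_left ih (by linarith)
      have e3 := abs_add_le (h (f (f^[k] x)) - (n : ℝ) * h (f^[k] x))
        ((n : ℝ) * (h (f^[k] x) - (n : ℝ) ^ k * h x))
      have e4 : h (f (f^[k] x)) - (n : ℝ) ^ (k + 1) * h x
        = (h (f (f^[k] x)) - (n : ℝ) * h (f^[k] x))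
          + (n : ℝ) * (h (f^[k] x) - (n : ℝ) ^ k * h x) := by ring
      rw [e4, pow_succ]
      nlinarith [mul_nonneg hC (by linarith : (0 : ℝ) ≤ (n : ℝ) - 2)]
  have h2 : ∀ x, |hcan x - h x| ≤ C := by
    intro x
    refine le_of_tendsto (((hlim x).sub_const (h x)).abs) (Filter.Eventually.of_forall fun k => ?_)
    have hp : (0 : ℝ) < (n : ℝ) ^ k := by positivity
    have e : h (f^[k] x) / (n : ℝ) ^ k - h x
        = (h (f^[k] x) - (n : ℝ) ^ k * h x) / (n : ℝ) ^ k := by field_simp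
    rw [e, abs_div, abs_of_pos hp, div_le_iff₀ hp]
    linarith [h1 k x]
  have hc : Function.Commute f f' := fun x => congrFun hcomm x
  have hz : ∀ (m : ℕ), (2 : ℝ) ≤ m → ∀ D : ℝ,
      Filter.Tendsto (fun k : ℕ => D / (m : ℝ) ^ k) Filter.atTop (nhds 0) := by
    intro m hm D
    exact (tendsto_pow_atTop_atTop_of_one_lt (by linarith : (1 : ℝ) < m)).const_div_atTop D
  have h3 : ∀ x, hcan (f' x) = n' * hcan x := by
    intro x
    have t := (hlim (f' x)).sub ((hlim x).const_mul (n' : ℝ))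
    have t0 : Filter.Tendsto (fun k : ℕ => h (f^[k] (f' x)) / (n : ℝ) ^ k
        - n' * (h (f^[k] x) / (n : ℝ) ^ k)) Filter.atTop (nhds 0) := by
      refine squeeze_zero_norm (fun k => ?_) (hz n hn0 C'')
      have hp : (0 : ℝ) < (n : ℝ) ^ k := by positivity
      rw [(hc.iterate_left k) x, Real.norm_eq_abs, ← mul_div_assoc, ← sub_div, abs_div,
        abs_of_pos hp]
      exact div_le_div_of_nonneg_right (hbd' _) hp.le
    linarith [tendsto_nhds_unique t t0]
  have h4 : ∀ (k : ℕ) (x : X), hcan (f'^[k] x) = (n' : ℝ) ^ k * hcan x := by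
    intro k x
    induction k with
    | zero => simp
    | succ k ih => rw [Function.iterate_succ_apply', h3, ih]; ring
  intro x
  rw [tendsto_iff_norm_sub_tendsto_zero]
  refine squeeze_zero (fun _ => norm_nonneg _) (fun k => ?_) (hz n' hn0' C)
  have hp : (0 : ℝ) < (n' : ℝ) ^ k := by positivity
  have e : h (f'^[k] x) / (n' : ℝ) ^ k - hcan x
      = (h (f'^[k] x) - hcan (f'^[k] x)) / (n' : ℝ) ^ k := by
    rw [h4]; field_simp
  rw [e, Real.norm_eq_abs, abs_div, abs_of_pos hp, abs_sub_comm]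
  exact div_le_div_of_nonneg_right (h2 _) hp.le
end

section
/- Let K be a number field with ring of integers O_K, and let I be a nonzero ideal of O_K. Then there exists a finite field extension K′ of K such that, denoting by O_{K′} the ring of integers of K′, the ideal of O_{K′} generated by the image of I is a principal ideal. -/
open NumberField

/-- Every nonzero ideal of the ring of integers of a number field becomes principal in the
ring of integers of a suitable finite extension. -/
theorem ideal_becomes_principal_in_finite_extension (K : Type) [Field K] [NumberField K]
    (I : Ideal (𝓞 K)) (hI : I ≠ ⊥) :
    ∃ (K' : Type) (_ : Field K') (_ : Algebra K K') (_ : FiniteDimensional K K'),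
      (I.map (algebraMap (𝓞 K) (𝓞 K'))).IsPrincipal := by
  classical
  have hmem : I ∈ nonZeroDivisors (Ideal (𝓞 K)) := mem_nonZeroDivisors_iff_ne_zero.mpr hI
  obtain ⟨h, hpos, hpow⟩ : ∃ h : ℕ, h ≠ 0 ∧ (I ^ h).IsPrincipal := by
    refine ⟨Fintype.card (ClassGroup (𝓞 K)), Fintype.card_ne_zero, ?_⟩
    rw [← ClassGroup.mk0_eq_one_iff (pow_mem hmem _)]
    have := pow_card_eq_one (x := ClassGroup.mk0 ⟨I, hmem⟩)
    rw [← map_pow] at this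
    exact this
  obtain ⟨a, ha⟩ := hpow
  let p : Polynomial K := Polynomial.X ^ h - Polynomial.C (a : K)
  have hdeg : p.degree ≠ 0 := by
    rw [Polynomial.degree_X_pow_sub_C (Nat.pos_of_ne_zero hpos)]
    exact_mod_cast hpos
  let L := p.SplittingField
  obtain ⟨b, hb⟩ : ∃ b : L, b ^ h = algebraMap K L a := by
    obtain ⟨b, hb⟩ := (Polynomial.SplittingField.splits p).exists_eval_eq_zero
      (by rwa [Polynomial.degree_map])
    refine ⟨b, ?_⟩
    simpa [p, sub_eq_zero] using hb
  haveI : NumberField L := NumberField.of_module_finite K L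
  have hbint : IsIntegral ℤ b := by
    refine IsIntegral.of_pow (Nat.pos_of_ne_zero hpos) ?_
    rw [hb]
    exact (RingOfIntegers.isIntegral_coe a).algebraMap
  refine ⟨L, inferInstance, inferInstance, inferInstance, ?_⟩
  let β : 𝓞 L := ⟨b, hbint⟩
  have hβ : β ^ h = algebraMap (𝓞 K) (𝓞 L) a := by
    apply RingOfIntegers.ext
    exact hb
  have key : (I.map (algebraMap (𝓞 K) (𝓞 L))) ^ h = (Ideal.span {β}) ^ h := by
    rw [← Ideal.map_pow, ha, Ideal.span_singleton_pow, hβ]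
    change Ideal.map _ (Ideal.span {a}) = _
    rw [Ideal.map_span, Set.image_singleton]
  have : I.map (algebraMap (𝓞 K) (𝓞 L)) = Ideal.span {β} := by
    apply le_antisymm
    · exact Ideal.dvd_iff_le.mp ((UniqueFactorizationMonoid.pow_dvd_pow_iff_dvd hpos).mp key.symm.dvd)
    · exact Ideal.dvd_iff_le.mp ((UniqueFactorizationMonoid.pow_dvd_pow_iff_dvd hpos).mp key.dvd)
  exact ⟨β, this⟩
end
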